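/- Let f be a matrix polynomial of degree 2m whose coefficients satisfy Condition C, and suppose Hermitian q×q matrices s_0, ..., s_{2m-1} are Markov parameters of f. Then for all x, y ∈ ℂ: f^♯(x)·f(−y) − f^♯(−x)·f(y) = 2(x−y)·[ R_e(x) · S(h^♯) · J̃_{m-1} · H_{2,m-1} · J̃_{m-1} · S(h) · C_e(y) − R_o(x) · S(h^♯) · J̃_{m-1} · H_{1,m-1} · J̃_{m-1} · S(h) · C_o(y) ], where R_e(x) is the block row (I_q, x² I_q, ..., x^{2m-2} I_q), C_e(y) the block column (I_q; y² I_q; ...; y^{2m-2} I_q), R_o(x) the block row (x I_q, x³ I_q, ..., x^{2m-1} I_q), and C_o(y) the block column (y I_q; y³ I_q; ...; y^{2m-1} I_q). -/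

import Mathlib

open Matrix MeasureTheory
open scoped ComplexOrder

noncomputable section

/-- The space of `q × q` complex matrices. -/
abbrev Mat (q : ℕ) := Matrix (Fin q) (Fin q) ℂ

/-- The h-part of an even-degree matrix polynomial
`f(z) = A 0 * z^(2m) + ... + A (2m)`:  `h(z) = A 0 * z^m + A 2 * z^(m-1) + ... + A (2m)`. -/
def hEven (q m : ℕ) (A : ℕ → Mat q) (z : ℂ) : Mat q :=
  ∑ j ∈ Finset.range (m + 1), z ^ (m - j) • A (2 * j)

/-- The g-part of an even-degree matrix polynomial:
`g(z) = A 1 * z^(m-1) + A 3 * z^(m-2) + ... + A (2m-1)`. -/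
def gEven (q m : ℕ) (A : ℕ → Mat q) (z : ℂ) : Mat q :=
  ∑ j ∈ Finset.range m, z ^ (m - 1 - j) • A (2 * j + 1)

/-- The h-part of an odd-degree matrix polynomial
`f(z) = A 0 * z^(2m+1) + ... + A (2m+1)`:  `h(z) = A 1 * z^m + ... + A (2m+1)`. -/
def hOdd (q m : ℕ) (A : ℕ → Mat q) (z : ℂ) : Mat q :=
  ∑ j ∈ Finset.range (m + 1), z ^ (m - j) • A (2 * j + 1)

/-- The g-part of an odd-degree matrix polynomial: `g(z) = A 0 * z^m + ... + A (2m)`. -/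
def gOdd (q m : ℕ) (A : ℕ → Mat q) (z : ℂ) : Mat q :=
  ∑ j ∈ Finset.range (m + 1), z ^ (m - j) • A (2 * j)

/-- The matrix polynomial `f(z) = A 0 * z^n + A 1 * z^(n-1) + ... + A n`. -/
def fPoly (q n : ℕ) (A : ℕ → Mat q) (z : ℂ) : Mat q :=
  ∑ j ∈ Finset.range (n + 1), z ^ (n - j) • A j

/-- Continued fraction for the even case:  `wEven q m c d j z = w_{m-1-j}(z)`, where
`w_{m-1}(z) = z c_{m-1} + d_{m-1}⁻¹` and `w_k(z) = z c_k + (d_k + w_{k+1}(z)⁻¹)⁻¹`. -/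
def wEven (q m : ℕ) (c d : ℕ → Mat q) : ℕ → ℂ → Mat q
  | 0, z => z • c (m - 1) + (d (m - 1))⁻¹
  | j + 1, z => z • c (m - 2 - j) + (d (m - 2 - j) + (wEven q m c d j z)⁻¹)⁻¹

/-- Continued fraction for the odd case:  `wOdd q m c d j z = w_{m-1-j}(z)`, where
`w_{m-1}(z) = z c_{m-1} + (d_{m-1} + z⁻¹ c_m⁻¹)⁻¹`. -/
def wOdd (q m : ℕ) (c d : ℕ → Mat q) : ℕ → ℂ → Mat q
  | 0, z => z • c (m - 1) + (d (m - 1) + z⁻¹ • (c m)⁻¹)⁻¹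
  | j + 1, z => z • c (m - 2 - j) + (d (m - 2 - j) + (wOdd q m c d j z)⁻¹)⁻¹

/-- A Hurwitz-type matrix polynomial of degree 2m, described through its h-part and g-part:
there are Hermitian positive definite matrices `c_0, ..., c_{m-1}`, `d_0, ..., d_{m-1}` with
`g(z) h(z)⁻¹ = w_0(z)⁻¹` whenever `det (h z) ≠ 0` and all inverses in the recursion exist. -/
def IsHTMEven (q m : ℕ) (h g : ℂ → Mat q) : Prop :=
  ∃ c d : ℕ → Mat q,
    (∀ k < m, (c k).PosDef) ∧ (∀ k < m, (d k).PosDef) ∧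
    ∀ z : ℂ, (h z).det ≠ 0 →
      (∀ j < m, IsUnit (wEven q m c d j z).det) →
      (∀ j, j + 1 < m → IsUnit (d (m - 2 - j) + (wEven q m c d j z)⁻¹).det) →
      g z * (h z)⁻¹ = (wEven q m c d (m - 1) z)⁻¹

/-- A Hurwitz-type matrix polynomial of degree 2m+1, described through its h-part and g-part:
there are Hermitian positive definite matrices `c_0, ..., c_m`, `d_0, ..., d_{m-1}` with
`h(z) (z g(z))⁻¹ = w_0(z)⁻¹` whenever `z ≠ 0`, `det (g z) ≠ 0` and all inverses exist. -/
def IsHTMOdd (q m : ℕ) (h g : ℂ → Mat q) : Prop :=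
  ∃ c d : ℕ → Mat q,
    (∀ k ≤ m, (c k).PosDef) ∧ (∀ k < m, (d k).PosDef) ∧
    ∀ z : ℂ, z ≠ 0 → (g z).det ≠ 0 →
      IsUnit (d (m - 1) + z⁻¹ • (c m)⁻¹).det →
      (∀ j < m, IsUnit (wOdd q m c d j z).det) →
      (∀ j, j + 1 < m → IsUnit (d (m - 2 - j) + (wOdd q m c d j z)⁻¹).det) →
      h z * (z • g z)⁻¹ = (wOdd q m c d (m - 1) z)⁻¹

/-- `s_0, ..., s_{2m-1}` are Markov parameters of the even-degree polynomial with
coefficients `A`:  `z^(2m) g(z) - (∑_{j<2m} (-1)^j s_j z^(2m-1-j)) h(z)` has degree ≤ m-1. -/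
def MarkovEven (q m : ℕ) (A s : ℕ → Mat q) : Prop :=
  ∃ B : ℕ → Mat q, ∀ z : ℂ,
    z ^ (2 * m) • gEven q m A z
      - (∑ j ∈ Finset.range (2 * m), ((-1 : ℂ) ^ j * z ^ (2 * m - 1 - j)) • s j) * hEven q m A z
    = ∑ k ∈ Finset.range m, z ^ k • B k

/-- `s_0, ..., s_{2m}` are Markov parameters of the odd-degree polynomial with coefficients
`A`:  `z^(2m+1) h(z) - (∑_{j≤2m} (-1)^j s_j z^(2m-j)) z g(z)` has degree ≤ m. -/
def MarkovOdd (q m : ℕ) (A s : ℕ → Mat q) : Prop :=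
  ∃ B : ℕ → Mat q, ∀ z : ℂ,
    z ^ (2 * m + 1) • hOdd q m A z
      - (∑ j ∈ Finset.range (2 * m + 1), ((-1 : ℂ) ^ j * z ^ (2 * m - j)) • s j) *
          (z • gOdd q m A z)
    = ∑ k ∈ Finset.range (m + 1), z ^ k • B k

/-- The block Hankel matrix `H_{1,n-1} = (s_{i+j})_{i,j=0}^{n-1}` with `n` block rows. -/
def H1b (q : ℕ) (s : ℕ → Mat q) (n : ℕ) : Matrix (Fin n × Fin q) (Fin n × Fin q) ℂ :=
  Matrix.of fun p r => s ((p.1 : ℕ) + (r.1 : ℕ)) p.2 r.2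

/-- The block Hankel matrix `H_{2,n-1} = (s_{i+j+1})_{i,j=0}^{n-1}` with `n` block rows. -/
def H2b (q : ℕ) (s : ℕ → Mat q) (n : ℕ) : Matrix (Fin n × Fin q) (Fin n × Fin q) ℂ :=
  Matrix.of fun p r => s ((p.1 : ℕ) + (r.1 : ℕ) + 1) p.2 r.2

/-- The block column `Y_{1,n} = (s_n; s_{n+1}; ...; s_{2n-1})`. -/
def Y1b (q : ℕ) (s : ℕ → Mat q) (n : ℕ) : Matrix (Fin n × Fin q) (Fin q) ℂ :=
  Matrix.of fun p b => s (n + (p.1 : ℕ)) p.2 b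

/-- The block column `Y_{2,n} = (s_{n+1}; ...; s_{2n})`. -/
def Y2b (q : ℕ) (s : ℕ → Mat q) (n : ℕ) : Matrix (Fin n × Fin q) (Fin q) ℂ :=
  Matrix.of fun p b => s (n + 1 + (p.1 : ℕ)) p.2 b

/-- The block column `col (I, z I, ..., z^(n-1) I)`. -/
def colPow (q n : ℕ) (z : ℂ) : Matrix (Fin n × Fin q) (Fin q) ℂ :=
  Matrix.of fun p b => z ^ (p.1 : ℕ) * (if p.2 = b then 1 else 0)

/-- `r_i(z) = ∑_{k=1}^{i} z^(i-k) s_{k-1}`. -/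
def rPol (q : ℕ) (s : ℕ → Mat q) (i : ℕ) (z : ℂ) : Mat q :=
  ∑ k ∈ Finset.range i, z ^ (i - 1 - k) • s k

/-- `t_i(z) = ∑_{k=0}^{i} z^(i-k) s_k`. -/
def tPol (q : ℕ) (s : ℕ → Mat q) (i : ℕ) (z : ℂ) : Mat q :=
  ∑ k ∈ Finset.range (i + 1), z ^ (i - k) • s k

/-- The block column `col (r_0(z), ..., r_{n-1}(z))`. -/
def colR (q : ℕ) (s : ℕ → Mat q) (n : ℕ) (z : ℂ) : Matrix (Fin n × Fin q) (Fin q) ℂ :=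
  Matrix.of fun p b => rPol q s (p.1 : ℕ) z p.2 b

/-- The block column `col (t_0(z), ..., t_{n-1}(z))`. -/
def colT (q : ℕ) (s : ℕ → Mat q) (n : ℕ) (z : ℂ) : Matrix (Fin n × Fin q) (Fin q) ℂ :=
  Matrix.of fun p b => tPol q s (p.1 : ℕ) z p.2 b

/-- `P_{1,j}(z) = z^j I - Y_{1,j}^* H_{1,j-1}⁻¹ col(I, zI, ..., z^(j-1) I)`. -/
def P1 (q : ℕ) (s : ℕ → Mat q) (j : ℕ) (z : ℂ) : Mat q :=
  z ^ j • (1 : Mat q) - (Y1b q s j)ᴴ * (H1b q s j)⁻¹ * colPow q j z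

/-- `P_{2,j}(z) = z^j I - Y_{2,j}^* H_{2,j-1}⁻¹ col(I, zI, ..., z^(j-1) I)`. -/
def P2 (q : ℕ) (s : ℕ → Mat q) (j : ℕ) (z : ℂ) : Mat q :=
  z ^ j • (1 : Mat q) - (Y2b q s j)ᴴ * (H2b q s j)⁻¹ * colPow q j z

/-- `Q_{1,j}(z) = r_j(z) - Y_{1,j}^* H_{1,j-1}⁻¹ col(r_0(z), ..., r_{j-1}(z))`. -/
def Q1 (q : ℕ) (s : ℕ → Mat q) (j : ℕ) (z : ℂ) : Mat q :=
  rPol q s j z - (Y1b q s j)ᴴ * (H1b q s j)⁻¹ * colR q s j z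

/-- `Q_{2,j}(z) = t_j(z) - Y_{2,j}^* H_{2,j-1}⁻¹ col(t_0(z), ..., t_{j-1}(z))`. -/
def Q2 (q : ℕ) (s : ℕ → Mat q) (j : ℕ) (z : ℂ) : Mat q :=
  tPol q s j z - (Y2b q s j)ᴴ * (H2b q s j)⁻¹ * colT q s j z

/-- The block column `e = (I; 0; ...; 0)` with `n` blocks. -/
def eCol (q n : ℕ) : Matrix (Fin n × Fin q) (Fin q) ℂ :=
  Matrix.of fun p b => if (p.1 : ℕ) = 0 then (if p.2 = b then 1 else 0) else 0

/-- The block column `y = (s_0; s_1; ...; s_{n-1})`. -/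
def yCol (q : ℕ) (s : ℕ → Mat q) (n : ℕ) : Matrix (Fin n × Fin q) (Fin q) ℂ :=
  Matrix.of fun p b => s (p.1 : ℕ) p.2 b

/-- Condition C: `A_i^* A_k = A_k^* A_i` for every odd `i` and even `k` with `i, k ≤ n`. -/
def CondC (q n : ℕ) (A : ℕ → Mat q) : Prop :=
  ∀ i k, i ≤ n → k ≤ n → i % 2 = 1 → k % 2 = 0 → (A i)ᴴ * A k = (A k)ᴴ * A i

/-- The symmetrizer: for a polynomial with (descending) coefficients `Q_0, ..., Q_{n-1}`
(read off as `Q_j = A (2j)`), the `n × n` block Hankel matrix whose `(i,k)` block is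
`A (2(n-1-i-k))` if `i + k ≤ n - 1`, and `0` otherwise. -/
def Sh (q n : ℕ) (A : ℕ → Mat q) : Matrix (Fin n × Fin q) (Fin n × Fin q) ℂ :=
  Matrix.of fun p r =>
    if (p.1 : ℕ) + (r.1 : ℕ) ≤ n - 1 then A (2 * (n - 1 - (p.1 : ℕ) - (r.1 : ℕ))) p.2 r.2
    else 0

/-- The signature matrix `J̃ = diag (I, -I, I, ..., ±I)` with `n` blocks. -/
def Jt (q n : ℕ) : Matrix (Fin n × Fin q) (Fin n × Fin q) ℂ :=
  Matrix.diagonal (fun p => (-1 : ℂ) ^ (p.1 : ℕ))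

/-- The block row `(I, x² I, ..., x^(2n-2) I)`. -/
def Rev (q n : ℕ) (x : ℂ) : Matrix (Fin q) (Fin n × Fin q) ℂ :=
  Matrix.of fun a p => x ^ (2 * (p.1 : ℕ)) * (if a = p.2 then 1 else 0)

/-- The block column `(I; y² I; ...; y^(2n-2) I)`. -/
def Cev (q n : ℕ) (y : ℂ) : Matrix (Fin n × Fin q) (Fin q) ℂ :=
  Matrix.of fun p b => y ^ (2 * (p.1 : ℕ)) * (if p.2 = b then 1 else 0)

/-- The block row `(x I, x³ I, ..., x^(2n-1) I)`. -/
def Rod (q n : ℕ) (x : ℂ) : Matrix (Fin q) (Fin n × Fin q) ℂ :=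
  Matrix.of fun a p => x ^ (2 * (p.1 : ℕ) + 1) * (if a = p.2 then 1 else 0)

/-- The block column `(y I; y³ I; ...; y^(2n-1) I)`. -/
def Cod (q n : ℕ) (y : ℂ) : Matrix (Fin n × Fin q) (Fin q) ℂ :=
  Matrix.of fun p b => y ^ (2 * (p.1 : ℕ) + 1) * (if p.2 = b then 1 else 0)

/-- The block column with blocks `B 0, ..., B (n-1)`. -/
def blockCol (q n : ℕ) (B : ℕ → Mat q) : Matrix (Fin n × Fin q) (Fin q) ℂ :=
  Matrix.of fun p b => B p.1 p.2 b

theorem blockMat_mul_blockCol (q n : ℕ) (K : ℕ → ℕ → Mat q) (B : ℕ → Mat q) :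
    (Matrix.of fun p r : Fin n × Fin q => K p.1 r.1 p.2 r.2) * blockCol q n B
      = blockCol q n fun i => ∑ k ∈ Finset.range n, K i k * B k := by
  ext p b
  simp [blockCol, Matrix.mul_apply, Fintype.sum_prod_type, Matrix.sum_apply, Finset.sum_range]

theorem blockRow_mul_blockCol (q n : ℕ) (R B : ℕ → Mat q) :
    (Matrix.of fun (a : Fin q) (p : Fin n × Fin q) => R p.1 a p.2) * blockCol q n B
      = ∑ k ∈ Finset.range n, R k * B k := by
  ext a b
  simp [blockCol, Matrix.mul_apply, Fintype.sum_prod_type, Matrix.sum_apply, Finset.sum_range]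

theorem Jt_mul_blockCol (q n : ℕ) (B : ℕ → Mat q) :
    Jt q n * blockCol q n B = blockCol q n fun i => (-1 : ℂ) ^ i • B i := by
  ext p b
  simp [Jt, blockCol, Matrix.diagonal_mul]

theorem H1b_mul_blockCol (q n : ℕ) (s B : ℕ → Mat q) :
    H1b q s n * blockCol q n B
      = blockCol q n fun i => ∑ k ∈ Finset.range n, s (i + k) * B k :=
  blockMat_mul_blockCol q n (fun i k => s (i + k)) B

theorem H2b_mul_blockCol (q n : ℕ) (s B : ℕ → Mat q) :
    H2b q s n * blockCol q n B
      = blockCol q n fun i => ∑ k ∈ Finset.range n, s (i + k + 1) * B k :=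
  blockMat_mul_blockCol q n (fun i k => s (i + k + 1)) B

theorem Sh_mul_blockCol (q n : ℕ) (A B : ℕ → Mat q) :
    Sh q n A * blockCol q n B
      = blockCol q n fun i => ∑ k ∈ Finset.range n,
          (if i + k ≤ n - 1 then A (2 * (n - 1 - i - k)) else 0) * B k := by
  rw [← blockMat_mul_blockCol]
  congr 1
  ext p r
  simp only [Sh, Matrix.of_apply]
  split_ifs <;> rfl

theorem Cev_eq_blockCol (q n : ℕ) (y : ℂ) :
    Cev q n y = blockCol q n fun k => (y ^ 2) ^ k • (1 : Mat q) := by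
  ext p b
  simp [Cev, blockCol, Matrix.one_apply, pow_mul]

theorem Rev_mul_blockCol (q n : ℕ) (x : ℂ) (B : ℕ → Mat q) :
    Rev q n x * blockCol q n B = ∑ k ∈ Finset.range n, (x ^ 2) ^ k • B k := by
  have h : Rev q n x = Matrix.of fun (a : Fin q) (p : Fin n × Fin q) =>
      ((x ^ 2) ^ (p.1 : ℕ) • (1 : Mat q)) a p.2 := by
    ext a p
    simp [Rev, Matrix.one_apply, pow_mul]
  rw [h, blockRow_mul_blockCol q n (fun k => (x ^ 2) ^ k • (1 : Mat q))]
  simp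

/-- The polynomial part of `v^(-1-i) * h(v)`, where `h` is the h-part of the coefficients `A`. -/
def hTail (q m : ℕ) (A : ℕ → Mat q) (i : ℕ) (v : ℂ) : Mat q :=
  ∑ k ∈ Finset.range m, v ^ k • (if i + k ≤ m - 1 then A (2 * (m - 1 - i - k)) else 0)

theorem hEven_eq_smul_hTail_zero_add {q m : ℕ} (hm : 1 ≤ m) (A : ℕ → Mat q) (v : ℂ) :
    hEven q m A v = v • hTail q m A 0 v + A (2 * m) := by
  rw [hEven, Finset.sum_range_succ, hTail, Finset.smul_sum, ← Finset.sum_range_reflect]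
  simp only [tsub_self, pow_zero, one_smul, add_left_inj]
  refine Finset.sum_congr rfl fun k hk => ?_
  have hk := Finset.mem_range.1 hk
  rw [if_pos (by omega), smul_smul, ← pow_succ']
  congr 2
  omega

theorem hTail_eq_smul_hTail_succ_add {q m i : ℕ} (hi : i < m) (A : ℕ → Mat q) (v : ℂ) :
    hTail q m A i v = v • hTail q m A (i + 1) v + A (2 * (m - 1 - i)) := by
  obtain ⟨m, rfl⟩ : ∃ n, m = n + 1 := ⟨m - 1, by omega⟩
  rw [hTail, hTail, Finset.sum_range_succ', Finset.sum_range_succ _ m,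
    if_neg (show ¬ i + 1 + m ≤ m + 1 - 1 by omega), if_pos (by omega), smul_zero, add_zero,
    Finset.smul_sum]
  simp only [pow_zero, one_smul, Nat.sub_zero, add_left_inj]
  refine Finset.sum_congr rfl fun k _ => ?_
  rw [smul_smul, ← pow_succ', show i + 1 + k = i + (k + 1) by omega,
    show m + 1 - 1 - (i + 1) - k = m + 1 - 1 - i - (k + 1) by omega]

theorem hTail_of_le {q m i : ℕ} (hm : 1 ≤ m) (hi : m ≤ i) (A : ℕ → Mat q) (v : ℂ) :
    hTail q m A i v = 0 :=
  Finset.sum_eq_zero fun k _ => by rw [if_neg (by omega), smul_zero]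

theorem hTail_conjTranspose (q m i : ℕ) (A : ℕ → Mat q) (v : ℂ) :
    hTail q m (fun j => (A j)ᴴ) i v = (hTail q m A i ((starRingEnd ℂ) v))ᴴ := by
  simp only [hTail, Matrix.conjTranspose_sum, Matrix.conjTranspose_smul, star_pow,
    starRingEnd_apply, star_star]
  refine Finset.sum_congr rfl fun k _ => ?_
  split_ifs <;> simp

/-- The sesquilinear form `∑ (-1)^(i+k) h_i^♯(u) t_{i+k} h_k(v)` in the tails `h_i` of the
h-part. -/
def tailForm (q m : ℕ) (A t : ℕ → Mat q) (u v : ℂ) : Mat q :=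
  ∑ i ∈ Finset.range m, hTail q m (fun j => (A j)ᴴ) i u *
    ((-1 : ℂ) ^ i • ∑ k ∈ Finset.range m, t (i + k) * ((-1 : ℂ) ^ k • hTail q m A k v))

theorem Sh_mul_Cev (q m : ℕ) (A : ℕ → Mat q) (y : ℂ) :
    Sh q m A * Cev q m y = blockCol q m fun i => hTail q m A i (y ^ 2) := by
  rw [Cev_eq_blockCol, Sh_mul_blockCol]
  simp [hTail]

theorem Cod_eq_smul_Cev (q n : ℕ) (y : ℂ) : Cod q n y = y • Cev q n y := by
  ext p b
  simp [Cod, Cev, pow_succ']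

theorem Rod_eq_smul_Rev (q n : ℕ) (x : ℂ) : Rod q n x = x • Rev q n x := by
  ext a p
  simp [Rod, Rev, pow_succ']

theorem Rev_mul_Sh_mul_blockCol (q m : ℕ) (A B : ℕ → Mat q) (x : ℂ) :
    Rev q m x * (Sh q m A * blockCol q m B)
      = ∑ i ∈ Finset.range m, hTail q m A i (x ^ 2) * B i := by
  rw [Sh_mul_blockCol, Rev_mul_blockCol]
  simp only [hTail, Finset.smul_sum, Finset.sum_mul, smul_mul_assoc]
  rw [Finset.sum_comm]
  refine Finset.sum_congr rfl fun i _ => Finset.sum_congr rfl fun k _ => ?_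
  rw [add_comm k i, Nat.sub_right_comm]

theorem Rev_mul_H1b_mul_Cev (q m : ℕ) (A s : ℕ → Mat q) (x y : ℂ) :
    Rev q m x * (Sh q m (fun i => (A i)ᴴ) * (Jt q m * (H1b q s m *
        (Jt q m * (Sh q m A * Cev q m y)))))
      = tailForm q m A s (x ^ 2) (y ^ 2) := by
  rw [Sh_mul_Cev, Jt_mul_blockCol, H1b_mul_blockCol, Jt_mul_blockCol, Rev_mul_Sh_mul_blockCol,
    tailForm]

theorem Rev_mul_H2b_mul_Cev (q m : ℕ) (A s : ℕ → Mat q) (x y : ℂ) :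
    Rev q m x * (Sh q m (fun i => (A i)ᴴ) * (Jt q m * (H2b q s m *
        (Jt q m * (Sh q m A * Cev q m y)))))
      = tailForm q m A (fun j => s (j + 1)) (x ^ 2) (y ^ 2) := by
  rw [Sh_mul_Cev, Jt_mul_blockCol, H2b_mul_blockCol, Jt_mul_blockCol, Rev_mul_Sh_mul_blockCol,
    tailForm]

theorem tailForm_conjTranspose {q m : ℕ} (A t : ℕ → Mat q)
    (ht : ∀ j < 2 * m - 1, (t j).IsHermitian) (u v : ℂ) :
    (tailForm q m A t u v)ᴴ
      = tailForm q m A t ((starRingEnd ℂ) v) ((starRingEnd ℂ) u) := by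
  simp only [tailForm, hTail_conjTranspose, Matrix.conjTranspose_sum, Matrix.conjTranspose_mul,
    Matrix.conjTranspose_smul, Matrix.conjTranspose_conjTranspose, Finset.smul_sum,
    Finset.mul_sum, star_pow, star_neg, star_one, Complex.conj_conj]
  rw [Finset.sum_comm]
  refine Finset.sum_congr rfl fun i hi => Finset.sum_congr rfl fun k hk => ?_
  have hi := Finset.mem_range.1 hi
  have hk := Finset.mem_range.1 hk
  rw [(ht (k + i) (by omega)).eq, add_comm k i]
  simp only [Matrix.smul_mul, Matrix.mul_smul, Matrix.mul_assoc]
  rw [smul_comm]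

theorem sum_ite_eq_zero_of_forall_sum_pow_smul_eq_zero {q : ℕ} {ι : Type*} (S : Finset ι)
    (e : ι → ℕ) (M : ι → Mat q) (h : ∀ z : ℂ, ∑ i ∈ S, z ^ e i • M i = 0) (n : ℕ) :
    ∑ i ∈ S, (if e i = n then M i else 0) = 0 := by
  ext a b
  have hp : ∑ i ∈ S, Polynomial.monomial (e i) (M i a b) = 0 := by
    refine Polynomial.funext fun z => ?_
    have := congrFun (congrFun (h z) a) b
    simp only [Matrix.sum_apply, Matrix.smul_apply, smul_eq_mul, Matrix.zero_apply] at this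
    simpa [Polynomial.eval_finsetSum, mul_comm] using this
  have := congrArg (fun p => p.coeff n) hp
  simp only [Polynomial.finsetSum_coeff, Polynomial.coeff_monomial, Polynomial.coeff_zero] at this
  rw [Matrix.sum_apply, Matrix.zero_apply, ← this]
  refine Finset.sum_congr rfl fun i _ => ?_
  split_ifs <;> rfl

/-- The coefficients of `z^(m-1), ..., z^(3m-1)` in the defining relation of the Markov
parameters. -/
theorem MarkovEven.sum_filter_add_eq {q m : ℕ} {A s : ℕ → Mat q} (hM : MarkovEven q m A s)
    {n : ℕ} (hn : n < 2 * m) :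
    ∑ p ∈ Finset.range (2 * m) ×ˢ Finset.range (m + 1) with p.1 + p.2 = n,
        (-1 : ℂ) ^ p.1 • (s p.1 * A (2 * p.2))
      = if n < m then A (2 * n + 1) else 0 := by
  obtain ⟨B, hB⟩ := hM
  have h : ∑ j ∈ Finset.range m, (if 2 * m + (m - 1 - j) = 3 * m - 1 - n then A (2 * j + 1) else 0)
      + (∑ p ∈ Finset.range (2 * m) ×ˢ Finset.range (m + 1),
          (if (2 * m - 1 - p.1) + (m - p.2) = 3 * m - 1 - n
            then -((-1 : ℂ) ^ p.1 • (s p.1 * A (2 * p.2))) else 0)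
        + ∑ k ∈ Finset.range m, if k = 3 * m - 1 - n then -B k else 0) = 0 := by
    have h := sum_ite_eq_zero_of_forall_sum_pow_smul_eq_zero
      ((Finset.range m).disjSum
        ((Finset.range (2 * m) ×ˢ Finset.range (m + 1)).disjSum (Finset.range m)))
      (Sum.elim (fun j => 2 * m + (m - 1 - j))
        (Sum.elim (fun p => (2 * m - 1 - p.1) + (m - p.2)) id))
      (Sum.elim (fun j => A (2 * j + 1))
        (Sum.elim (fun p => -((-1 : ℂ) ^ p.1 • (s p.1 * A (2 * p.2)))) (fun k => -B k)))
      (fun z => by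
        have hz := hB z
        rw [← sub_eq_zero] at hz
        rw [← hz]
        simp only [Finset.sum_disjSum, Sum.elim_inl, Sum.elim_inr, id, smul_neg,
          Finset.sum_neg_distrib, gEven, hEven, Finset.smul_sum, smul_smul, ← pow_add,
          Finset.sum_mul_sum, Finset.sum_product, smul_mul_smul_comm]
        rw [sub_sub, sub_eq_add_neg, neg_add]
        congr 3
        refine Finset.sum_congr rfl fun j _ => Finset.sum_congr rfl fun k _ => ?_
        rw [pow_add]
        congr 1
        ring) (3 * m - 1 - n)
    rwa [Finset.sum_disjSum, Finset.sum_disjSum] at h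
  have h₁ : ∑ j ∈ Finset.range m, (if 2 * m + (m - 1 - j) = 3 * m - 1 - n then A (2 * j + 1) else 0)
      = if n < m then A (2 * n + 1) else 0 := by
    simp only [← Finset.mem_range]
    rw [← Finset.sum_ite_eq' (Finset.range m) n (fun j => A (2 * j + 1))]
    refine Finset.sum_congr rfl fun j hj => if_congr ?_ rfl rfl
    have := Finset.mem_range.1 hj
    omega
  have h₃ : ∑ k ∈ Finset.range m, (if k = 3 * m - 1 - n then -B k else 0) = 0 :=
    Finset.sum_eq_zero fun k hk => if_neg (by have := Finset.mem_range.1 hk; omega)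
  rw [h₁, h₃, add_zero, ← Finset.sum_filter, Finset.sum_neg_distrib, ← sub_eq_add_neg,
    sub_eq_zero] at h
  rw [h]
  refine Finset.sum_congr (Finset.filter_congr fun p hp => ?_) fun _ _ => rfl
  simp only [Finset.mem_product, Finset.mem_range] at hp
  omega

theorem MarkovEven.sum_mul_eq_odd {q m : ℕ} {A s : ℕ → Mat q} (hM : MarkovEven q m A s)
    {n : ℕ} (hn : n < m) :
    ∑ j ∈ Finset.range (n + 1), (-1 : ℂ) ^ j • (s j * A (2 * (n - j))) = A (2 * n + 1) := by
  have h := hM.sum_filter_add_eq (show n < 2 * m by omega)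
  rw [if_pos hn] at h
  rw [← h]
  refine Finset.sum_nbij' (fun j => (j, n - j)) Prod.fst ?_ ?_ ?_ ?_ ?_ <;>
    simp only [Finset.mem_filter, Finset.mem_product, Finset.mem_range, Prod.ext_iff] <;>
    grind

theorem MarkovEven.sum_mul_eq_zero {q m : ℕ} {A s : ℕ → Mat q} (hM : MarkovEven q m A s)
    {i : ℕ} (hi : i < m) :
    ∑ k ∈ Finset.range (m + 1), (-1 : ℂ) ^ k • (s (i + k) * A (2 * (m - k))) = 0 := by
  have h := hM.sum_filter_add_eq (show i + m < 2 * m by omega)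
  rw [if_neg (by omega)] at h
  have h' : ∑ k ∈ Finset.range (m + 1), (-1 : ℂ) ^ (i + k) • (s (i + k) * A (2 * (m - k))) = 0 := by
    rw [← h]
    refine Finset.sum_nbij' (fun k => (i + k, m - k)) (fun p => p.1 - i) ?_ ?_ ?_ ?_ ?_ <;>
      simp only [Finset.mem_filter, Finset.mem_product, Finset.mem_range, Prod.ext_iff] <;>
      grind
  simp only [pow_add, mul_smul, ← Finset.smul_sum] at h'
  exact (smul_eq_zero.1 h').resolve_left (pow_ne_zero _ (by norm_num))

theorem MarkovEven.gEven_eq_sum_hTail {q m : ℕ} {A s : ℕ → Mat q} (hM : MarkovEven q m A s)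
    (v : ℂ) :
    gEven q m A v = ∑ i ∈ Finset.range m, (-1 : ℂ) ^ i • (s i * hTail q m A i v) := by
  simp only [hTail, Finset.mul_sum, Finset.smul_sum]
  rw [Finset.sum_comm, gEven, ← Finset.sum_range_reflect]
  refine Finset.sum_congr rfl fun l hl => ?_
  have hl := Finset.mem_range.1 hl
  rw [← hM.sum_mul_eq_odd (show m - 1 - l < m by omega), Finset.smul_sum,
    show m - 1 - (m - 1 - l) = l by omega]
  refine Finset.sum_subset_zero_on_sdiff (fun i => ?_) (fun i hi => ?_) (fun i hi => ?_)
  · simp only [Finset.mem_range]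
    omega
  · simp only [Finset.mem_sdiff, Finset.mem_range] at hi
    rw [if_neg (by omega), smul_zero, mul_zero, smul_zero]
  · have hi := Finset.mem_range.1 hi
    rw [if_pos (by omega), Matrix.mul_smul, smul_comm, Nat.sub_right_comm]

theorem sum_mul_hTail_add {q m : ℕ} (hm : 1 ≤ m) (A s : ℕ → Mat q) (i : ℕ) (v : ℂ) {n : ℕ}
    (hn : n ≤ m) :
    ∑ k ∈ Finset.range n, (-1 : ℂ) ^ k •
        (s (i + k + 1) * hTail q m A k v + v • (s (i + k) * hTail q m A k v))
      = s i * hEven q m A v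
        - ∑ k ∈ Finset.range (n + 1), (-1 : ℂ) ^ k • (s (i + k) * A (2 * (m - k)))
        - (-1 : ℂ) ^ n • v • (s (i + n) * hTail q m A n v) := by
  induction n with
  | zero => simp [hEven_eq_smul_hTail_zero_add hm, mul_add]
  | succ n ih =>
    rw [Finset.sum_range_succ, ih (by omega), Finset.sum_range_succ _ (n + 1),
      hTail_eq_smul_hTail_succ_add (show n < m by omega), show m - (n + 1) = m - 1 - n by omega,
      ← add_assoc i n 1]
    simp only [mul_add, Matrix.mul_smul, pow_succ]
    module

theorem MarkovEven.sum_mul_hTail {q m : ℕ} (hm : 1 ≤ m) {A s : ℕ → Mat q}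
    (hM : MarkovEven q m A s) {i : ℕ} (hi : i < m) (v : ℂ) :
    ∑ k ∈ Finset.range m, (-1 : ℂ) ^ k •
        (s (i + k + 1) * hTail q m A k v + v • (s (i + k) * hTail q m A k v))
      = s i * hEven q m A v := by
  rw [sum_mul_hTail_add hm A s i v le_rfl, hM.sum_mul_eq_zero hi, hTail_of_le hm le_rfl]
  simp

theorem MarkovEven.tailForm_add_right {q m : ℕ} (hm : 1 ≤ m) {A s : ℕ → Mat q}
    (hs : ∀ j < 2 * m, (s j).IsHermitian) (hM : MarkovEven q m A s) (u v : ℂ) :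
    tailForm q m A (fun j => s (j + 1)) u v + v • tailForm q m A s u v
      = (gEven q m A ((starRingEnd ℂ) u))ᴴ * hEven q m A v := by
  rw [hM.gEven_eq_sum_hTail, Matrix.conjTranspose_sum, Finset.sum_mul, tailForm, tailForm,
    Finset.smul_sum, ← Finset.sum_add_distrib]
  refine Finset.sum_congr rfl fun i hi => ?_
  have hi := Finset.mem_range.1 hi
  rw [Matrix.conjTranspose_smul, Matrix.conjTranspose_mul, (hs i (by omega)).eq,
    ← hTail_conjTranspose, smul_mul_assoc, Matrix.mul_assoc, ← hM.sum_mul_hTail hm hi,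
    ← Matrix.mul_smul, ← Matrix.mul_smul, ← mul_add, smul_comm v, ← smul_add, Finset.smul_sum,
    ← Finset.sum_add_distrib, star_pow, star_neg, star_one]
  congr 2
  refine Finset.sum_congr rfl fun k _ => ?_
  simp only [Matrix.mul_smul, smul_add]
  rw [smul_comm v]

theorem MarkovEven.tailForm_add_left {q m : ℕ} (hm : 1 ≤ m) {A s : ℕ → Mat q}
    (hs : ∀ j < 2 * m, (s j).IsHermitian) (hM : MarkovEven q m A s) (u v : ℂ) :
    tailForm q m A (fun j => s (j + 1)) u v + u • tailForm q m A s u v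
      = (hEven q m A ((starRingEnd ℂ) u))ᴴ * gEven q m A v := by
  have h := congrArg Matrix.conjTranspose
    (hM.tailForm_add_right hm hs ((starRingEnd ℂ) v) ((starRingEnd ℂ) u))
  rw [Matrix.conjTranspose_add, Matrix.conjTranspose_smul, Matrix.conjTranspose_mul,
    tailForm_conjTranspose A s fun j hj => hs j (by omega),
    tailForm_conjTranspose A _ fun j hj => hs (j + 1) (by omega)] at h
  simpa using h

theorem fPoly_eq_hEven_add_smul_gEven (q m : ℕ) (A : ℕ → Mat q) (z : ℂ) :
    fPoly q (2 * m) A z = hEven q m A (z ^ 2) + z • gEven q m A (z ^ 2) := by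
  have hsplit : ∀ (F : ℕ → Mat q) (n : ℕ), ∑ j ∈ Finset.range (2 * n + 1), F j
      = ∑ j ∈ Finset.range (n + 1), F (2 * j) + ∑ j ∈ Finset.range n, F (2 * j + 1) := by
    intro F n
    induction n with
    | zero => simp
    | succ n ih =>
      rw [show 2 * (n + 1) + 1 = 2 * n + 1 + 1 + 1 by ring, Finset.sum_range_succ,
        Finset.sum_range_succ, ih, Finset.sum_range_succ _ (n + 1), Finset.sum_range_succ _ n,
        Finset.sum_range_succ _ n, show 2 * (n + 1) = 2 * n + 1 + 1 by ring]
      abel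
  rw [fPoly, hsplit, hEven, gEven, Finset.smul_sum]
  congr 1 <;> refine Finset.sum_congr rfl fun j hj => ?_
  · rw [← pow_mul, Nat.mul_sub]
  · have hj := Finset.mem_range.1 hj
    rw [smul_smul, ← pow_mul, ← pow_succ']
    congr 2
    omega

theorem stmt_13 (q m : ℕ) (hq : 1 ≤ q) (hm : 1 ≤ m) (A s : ℕ → Mat q)
    (hA0 : (A 0).det ≠ 0) (hC : CondC q (2 * m) A)
    (hherm : ∀ j < 2 * m, (s j).IsHermitian) (hM : MarkovEven q m A s) :
    ∀ x y : ℂ,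
      (fPoly q (2 * m) A ((starRingEnd ℂ) x))ᴴ * fPoly q (2 * m) A (-y)
          - (fPoly q (2 * m) A ((starRingEnd ℂ) (-x)))ᴴ * fPoly q (2 * m) A y
        = (2 * (x - y)) •
            (Rev q m x * (Sh q m (fun i => (A i)ᴴ) * (Jt q m * (H2b q s m *
                (Jt q m * (Sh q m A * Cev q m y)))))
              - Rod q m x * (Sh q m (fun i => (A i)ᴴ) * (Jt q m * (H1b q s m *
                (Jt q m * (Sh q m A * Cod q m y)))))) := by
  intro x y
  have hr := hM.tailForm_add_right hm hherm (x ^ 2) (y ^ 2)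
  have hl := hM.tailForm_add_left hm hherm (x ^ 2) (y ^ 2)
  rw [Rod_eq_smul_Rev, Cod_eq_smul_Cev]
  simp only [Matrix.mul_smul, Matrix.smul_mul]
  rw [Rev_mul_H1b_mul_Cev, Rev_mul_H2b_mul_Cev]
  simp only [fPoly_eq_hEven_add_smul_gEven, map_neg, star_pow, Matrix.conjTranspose_add,
    Matrix.conjTranspose_smul, starRingEnd_apply, star_neg, neg_sq, star_star] at hr hl ⊢
  simp only [add_mul, mul_add, Matrix.smul_mul, Matrix.mul_smul, ← hr, ← hl]
  module

end
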